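/- Suppose p < 1/2 and β ≥ 4/7. Then the discrete-time exclusion-voter chain is recurrent: for every initial configuration S₀ ∈ 𝒟, Pr_{β,p}(τ < ∞ | ξ₀ = S₀) = 1. -/

import Mathlib

open MeasureTheory Filter
open scoped ENNReal NNReal

namespace EV

/-- A configuration of the exclusion-voter model is the finite hybrid-zone word
(`false` = 0, `true` = 1); the full two-sided configuration is `1^∞ w 0^∞`. -/
abbrev Word := List Bool

/-- Canonical (normalized) words: empty (the ground state `𝒟₀`) or starting with
a `0` and ending with a `1`; these are in bijection with the configuration space `𝒟`. -/
def IsConfig (w : Word) : Prop :=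
  w = [] ∨ (w.head? = some false ∧ w.getLast? = some true)

/-- The ground-state Heaviside configuration `𝒟₀ = …111000…`. -/
def groundState : Word := []

/-- Pad a word with one boundary symbol of the adjacent infinite block on each side. -/
def pad (w : Word) : Word := true :: (w ++ [false])

/-- Normalize: strip leading `1`s (they merge into the left infinite block of `1`s)
and trailing `0`s (they merge into the right infinite block of `0`s). -/
def strip (w : Word) : Word :=
  ((w.dropWhile (· = true)).reverse.dropWhile (· = false)).reverse

def setPair (w : Word) (i : ℕ) (a b : Bool) : Word := (w.set i a).set (i + 1) b

def swapPair (w : Word) (i : ℕ) : Word :=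
  setPair w i (w.getD (i + 1) true) (w.getD i true)

/-- Indices of the unlike adjacent pairs (`01` or `10`), read off the padded word. -/
def unlike (w : Word) : List ℕ :=
  (List.range (w.length + 1)).filter
    (fun i => (pad w).getD i true ≠ (pad w).getD (i + 1) true)

/-- One-step transition kernel of the discrete-time exclusion-voter chain with mixing
parameter `β` and exclusion parameter `p`: an unlike adjacent pair is chosen uniformly
at random; with probability `β` a voter move flips the pair to `00` or `11` (each with
probability `1/2`); with probability `1-β` an exclusion move swaps a `01` with
probability `p` and a `10` with probability `1-p` (otherwise no change). -/
noncomputable def P (β p : ℝ) (w w' : Word) : ℝ :=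
  ((unlike w).map (fun i =>
    let a := (pad w).getD i true
    let swapProb := if a then 1 - p else p
    ((unlike w).length : ℝ)⁻¹ *
      (β * (1 / 2) * (if strip (setPair (pad w) i false false) = w' then 1 else 0)
       + β * (1 / 2) * (if strip (setPair (pad w) i true true) = w' then 1 else 0)
       + (1 - β) * swapProb * (if strip (swapPair (pad w) i) = w' then 1 else 0)
       + (1 - β) * (1 - swapProb) * (if w = w' then 1 else 0)))).sum

/-- `n`-step transition probabilities. -/
noncomputable def Pn (β p : ℝ) : ℕ → Word → Word → ℝ
  | 0 => fun w w' => if w = w' then 1 else 0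
  | n + 1 => fun w w' => ∑' z : Word, Pn β p n w z * P β p z w'

/-- `w'` is accessible from `w`: some `n`-step transition probability is positive. -/
def Accessible (β p : ℝ) (w w' : Word) : Prop :=
  ∃ n : ℕ, 0 < n ∧ 0 < Pn β p n w w'

/-- Two states communicate: each is accessible from the other. -/
def Communicate (β p : ℝ) (w w' : Word) : Prop :=
  Accessible β p w w' ∧ Accessible β p w' w

instance : MeasurableSpace Word := ⊤

/-- `ξ` is (a realization of) the discrete-time exclusion-voter Markov chain with
parameters `(β, p)` under the probability measure `μ`. -/
def IsEVChain (β p : ℝ) {Ω : Type*} [MeasurableSpace Ω] (μ : Measure Ω)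
    (ξ : ℕ → Ω → Word) : Prop :=
  (∀ t, Measurable (ξ t)) ∧
  ∀ (t : ℕ) (path : ℕ → Word),
    μ {ω | ∀ i ≤ t + 1, ξ i ω = path i}
      = μ {ω | ∀ i ≤ t, ξ i ω = path i} * ENNReal.ofReal (P β p (path t) (path (t + 1)))

/-- The relaxation time `τ = min {t ∈ ℕ, t ≥ 1 : ξ_t = 𝒟₀}` (`∞` if there is no such `t`). -/
noncomputable def relaxTime {Ω : Type*} (ξ : ℕ → Ω → Word) (ω : Ω) : ℝ≥0∞ :=
  sInf {r : ℝ≥0∞ | ∃ t : ℕ, 0 < t ∧ ξ t ω = groundState ∧ r = (t : ℝ≥0∞)}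

/-- The size `|S|` of the hybrid zone. -/
def hz (w : Word) : ℕ := w.length

/-- The number of blocks `N(S)`: the number of (finite) `1`-blocks of the hybrid zone. -/
def nb (w : Word) : ℕ :=
  ((Finset.range w.length).filter
    (fun b => w.getD b false = true ∧ (b = 0 ∨ w.getD (b - 1) true = false))).card

/-- Number of `0`s among the first `c` positions of the hybrid zone. -/
def z0 (w : Word) (c : ℕ) : ℕ :=
  ((Finset.range c).filter (fun a => w.getD a true = false)).card

/-- Number of `1`s of the hybrid zone at positions `≥ c`. -/
def o1 (w : Word) (c : ℕ) : ℕ :=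
  ((Finset.Ico c w.length).filter (fun b => w.getD b false = true)).card

/-- `f₁(S) = Σᵢ mᵢ Rᵢ = Σᵢ nᵢ Tᵢ`: each `1` contributes the number of `0`s to its left. -/
def f1 (w : Word) : ℕ :=
  ∑ b ∈ (Finset.range w.length).filter (fun b => w.getD b false = true), z0 w b

/-- `f₂(S) = (1/2)(Σᵢ mᵢ Rᵢ² + Σᵢ nᵢ Tᵢ²)`: each `1` contributes the squared number of
`0`s to its left, each `0` the squared number of `1`s to its right. -/
noncomputable def f2 (w : Word) : ℝ :=
  (1 / 2) *
    ((∑ b ∈ (Finset.range w.length).filter (fun b => w.getD b false = true),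
        ((z0 w b : ℝ)) ^ 2)
     + (∑ a ∈ (Finset.range w.length).filter (fun a => w.getD a true = false),
        ((o1 w (a + 1) : ℝ)) ^ 2))

/-- `g(S) = max_{1 ≤ k ≤ N} R_k T_k`: the maximum over the `01`-corners of
(number of `0`s up to the corner) × (number of `1`s after the corner). -/
def gfun (w : Word) : ℕ :=
  ((Finset.range w.length).filter
    (fun a => w.getD a true = false ∧ w.getD (a + 1) false = true)).sup
    (fun a => z0 w (a + 1) * o1 w (a + 1))

/-- `φ₁(S) = Σᵢ Σ_{j=R_{i-1}+1}^{R_i} Σ_{k=1}^{T_i} 1/(j+k)`: the `j`-th `0` (at position `a`,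
so `j = z0 w (a+1)`) contributes `Σ_{k=1}^{T} 1/(j+k)` with `T` the number of `1`s to its right. -/
noncomputable def phi1 (w : Word) : ℝ :=
  ∑ a ∈ (Finset.range w.length).filter (fun a => w.getD a true = false),
    ∑ k ∈ Finset.Icc 1 (o1 w (a + 1)), (1 : ℝ) / ((z0 w (a + 1) : ℝ) + (k : ℝ))


/-! ### The height walk of a word

Reading a word from left to right, a `0` raises the height by one and a `1` lowers it by one.
Started from the number of `1`s, the height at a boundary is the number of `0`s to its left
plus the number of `1`s to its right. -/

/-- The total height increment of a word. -/
def height : Word → ℤ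
  | [] => 0
  | true :: w => -1 + height w
  | false :: w => 1 + height w

/-- The sum of `f` over the heights from which a `0` is read, starting from height `s`. -/
def zeroSum (f : ℤ → ℝ) : ℤ → Word → ℝ
  | _, [] => 0
  | s, true :: w => zeroSum f (s - 1) w
  | s, false :: w => f s + zeroSum f (s + 1) w

/-- The decrease of `f` along the up-steps of the walk, plus the value of `f` at the end. -/
def variation (f : ℤ → ℝ) : ℤ → Word → ℝ
  | s, [] => f s
  | s, true :: w => variation f (s - 1) w
  | s, false :: w => f s - f (s + 1) + variation f (s + 1) w

/-- The sum of `F a σ` over the unlike adjacent pairs of a word, where `a` is the first symbol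
of the pair and `σ` the height in the middle of the pair. -/
def cornerSum (F : Bool → ℤ → ℝ) : ℤ → Word → ℝ
  | _, [] => 0
  | _, [_] => 0
  | s, true :: b :: v => (if b then 0 else F true (s - 1)) + cornerSum F (s - 1) (b :: v)
  | s, false :: b :: v => (if b then F false (s + 1) else 0) + cornerSum F (s + 1) (b :: v)

/-- The positions of the unlike adjacent pairs of a word. -/
def corners (x : Word) : List ℕ :=
  (List.range (x.length - 1)).filter (fun i => x.getD i true ≠ x.getD (i + 1) true)

lemma height_append (u v : Word) : height (u ++ v) = height u + height v := by
  induction u with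
  | nil => simp [height]
  | cons a u ih => cases a <;> simp [height, ih] <;> ring

lemma count_true_add_height (x : Word) : (x.count true : ℤ) + height x = x.count false := by
  induction x with
  | nil => simp [height]
  | cons a u ih => cases a <;> simp [height] <;> linarith

lemma zeroSum_append (f : ℤ → ℝ) (s : ℤ) (u v : Word) :
    zeroSum f s (u ++ v) = zeroSum f s u + zeroSum f (s + height u) v := by
  induction u generalizing s with
  | nil => simp [zeroSum, height]
  | cons a u ih =>
    cases a <;> simp only [List.cons_append, zeroSum, height, ih, ← add_assoc, ← sub_eq_add_neg]

lemma variation_eq (f : ℤ → ℝ) (s : ℤ) (w : Word) :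
    variation f s w = zeroSum (fun t => f t - f (t + 1)) s w + f (s + height w) := by
  induction w generalizing s with
  | nil => simp [zeroSum, height, variation]
  | cons a u ih =>
    cases a <;> simp only [zeroSum, variation, height, ih, ← add_assoc, ← sub_eq_add_neg]

lemma le_variation {f : ℤ → ℝ} (hf : Antitone f) (s : ℤ) (w : Word) : f s ≤ variation f s w := by
  induction w generalizing s with
  | nil => simp [variation]
  | cons a u ih =>
    cases a
    · have := ih (s + 1)
      simp only [variation]
      linarith
    · exact (hf (by lia : s - 1 ≤ s)).trans (ih (s - 1))

lemma sum_corners_cons (g : ℕ → ℝ) (a b : Bool) (v : Word) :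
    ((corners (a :: b :: v)).map g).sum
      = (if a = b then 0 else g 0) + ((corners (b :: v)).map (fun i => g (i + 1))).sum := by
  have h : corners (a :: b :: v)
      = (if a = b then [] else [0]) ++ (corners (b :: v)).map Nat.succ := by
    simp only [corners, List.length_cons, Nat.add_sub_cancel, List.range_succ_eq_map,
      List.filter_cons, List.filter_map]
    cases a <;> cases b <;> simp [Function.comp_def]
  rw [h]
  split_ifs <;> simp [Function.comp_def]

lemma sum_corners (F : Bool → ℤ → ℝ) (s : ℤ) (x : Word) :
    ((corners x).map (fun i => F (x.getD i true) (s + height (x.take (i + 1))))).sum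
      = cornerSum F s x := by
  induction x generalizing s with
  | nil => simp [corners, cornerSum]
  | cons a u ih =>
    cases u with
    | nil => simp [corners, cornerSum]
    | cons b v =>
      rw [sum_corners_cons]
      cases a
      · rw [cornerSum, ← ih (s + 1)]
        cases b <;> simp [height, add_assoc]
      · rw [cornerSum, ← ih (s - 1)]
        cases b <;> simp only [height, List.take_succ_cons, List.take_zero, ← add_assoc,
          sub_eq_add_neg] <;> simp

lemma cornerSum_add (F G : Bool → ℤ → ℝ) (s : ℤ) (x : Word) :
    cornerSum (fun a σ => F a σ + G a σ) s x = cornerSum F s x + cornerSum G s x := by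
  simp only [← sum_corners, List.sum_map_add]

lemma cornerSum_const_mul (c : ℝ) (F : Bool → ℤ → ℝ) (s : ℤ) (x : Word) :
    cornerSum (fun a σ => c * F a σ) s x = c * cornerSum F s x := by
  simp only [← sum_corners, List.sum_map_mul_left]

lemma cornerSum_mono {F G : Bool → ℤ → ℝ} (h : ∀ a σ, F a σ ≤ G a σ) (s : ℤ) (x : Word) :
    cornerSum F s x ≤ cornerSum G s x := by
  simp only [← sum_corners]
  exact List.sum_le_sum fun i _ => h _ _

lemma cornerSum_true_true (F : Bool → ℤ → ℝ) (s : ℤ) (v : Word) :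
    cornerSum F s (true :: true :: v) = cornerSum F (s - 1) (true :: v) := by
  simp [cornerSum]

/-- Alternating sums of `f` over the extrema of the walk telescope. -/
lemma cornerSum_alternating (f : ℤ → ℝ) (s : ℤ) (a : Bool) (v : Word) :
    cornerSum (fun a σ => if a then f σ else -f σ) s (a :: (v ++ [false]))
      = variation f s (a :: (v ++ [false])) - if a then 0 else f s := by
  induction v generalizing s a with
  | nil => cases a <;> simp [cornerSum, variation]
  | cons b v ih =>
    cases a <;> cases b <;> simp [cornerSum, variation, ih] <;> ring

lemma cornerSum_alternating_pad (f : ℤ → ℝ) (s : ℤ) (w : Word) :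
    cornerSum (fun a σ => if a then f σ else -f σ) s (pad w) = variation f s (pad w) := by
  simpa [pad] using cornerSum_alternating f s true w

lemma variation_const (s : ℤ) (w : Word) : variation (fun _ => 1) s w = 1 := by
  induction w generalizing s with
  | nil => simp [variation]
  | cons a u ih => cases a <;> simp [variation, ih]

/-- The number of maxima of the walk. -/
def numMax (s : ℤ) (x : Word) : ℝ := cornerSum (fun a _ => if a then 0 else 1) s x

lemma numMax_nonneg (s : ℤ) (x : Word) : 0 ≤ numMax s x := by
  rw [numMax, ← sum_corners]
  refine List.sum_nonneg fun r hr => ?_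
  obtain ⟨i, -, rfl⟩ := List.mem_map.1 hr
  split_ifs <;> norm_num

lemma numMin_pad (s : ℤ) (w : Word) :
    cornerSum (fun a _ => if a then 1 else 0) s (pad w) = numMax s (pad w) + 1 := by
  have h := cornerSum_alternating_pad (fun _ => 1) s w
  rw [variation_const] at h
  have h2 := cornerSum_add (fun a _ => if a then 0 else 1) (fun a _ => if a then 1 else -1) s
    (pad w)
  rw [h] at h2
  rw [numMax, ← h2]
  congr 1
  funext a σ
  cases a <;> simp

lemma length_corners_pad (s : ℤ) (w : Word) :
    ((corners (pad w)).length : ℝ) = 2 * numMax s (pad w) + 1 := by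
  have h : ((corners (pad w)).length : ℝ) = cornerSum (fun _ _ => 1) s (pad w) := by
    simp [← sum_corners]
  have h2 := cornerSum_add (fun a _ => if a then 1 else 0) (fun a _ => if a then 0 else 1) s (pad w)
  rw [numMin_pad, ← numMax] at h2
  rw [h, two_mul, add_assoc, add_comm _ (1 : ℝ), ← add_assoc, ← h2]
  congr 1
  funext a σ
  cases a <;> simp

lemma cornerSum_min_le {f : ℤ → ℝ} (hf : Antitone f) {C : ℝ} (s : ℤ) (x : Word)
    (hC : variation f s x ≤ C) :
    cornerSum (fun a σ => if a then f (σ + 1) else 0) s x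
      ≤ C * cornerSum (fun a _ => if a then 1 else 0) s x := by
  induction x generalizing s with
  | nil => simp [cornerSum]
  | cons a u ih =>
    cases u with
    | nil => simp [cornerSum]
    | cons b v =>
      cases a
      · have h1 := ih (s + 1) (by
          have := hf (by lia : s ≤ s + 1)
          rw [variation] at hC
          linarith)
        simpa [cornerSum] using h1
      · rw [variation] at hC
        have h1 := ih (s - 1) hC
        have h2 := (hf (by lia : s - 1 ≤ s)).trans ((le_variation hf _ _).trans hC)
        cases b
        · simp only [cornerSum, mul_add]
          simp at h1 ⊢
          linarith
        · simpa [cornerSum] using h1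

/-! ### Block structure of configurations -/

lemma exists_replicate_append (a : Bool) (w : Word) :
    ∃ n v, w = List.replicate n a ++ v ∧ v.head? ≠ some a := by
  induction w with
  | nil => exact ⟨0, [], by simp⟩
  | cons b w ih =>
    by_cases hb : b = a
    · obtain ⟨n, v, rfl, hv⟩ := ih
      exact ⟨n + 1, v, by simp [hb, List.replicate_succ], hv⟩
    · exact ⟨0, b :: w, by simp [hb]⟩

lemma IsConfig.exists_block {w : Word} (hw : IsConfig w) (h : w ≠ []) :
    ∃ (a b : ℕ) (v : Word),
      w = List.replicate (a + 1) false ++ (List.replicate (b + 1) true ++ v) ∧ IsConfig v := by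
  obtain ⟨h0, h1⟩ := hw.resolve_left h
  obtain ⟨n, u, rfl, hu⟩ := exists_replicate_append false w
  obtain ⟨m, v, rfl, hv⟩ := exists_replicate_append true u
  cases n with
  | zero => simp_all
  | succ a =>
    cases m with
    | zero =>
      cases v with
      | nil => simp [List.getLast?_replicate] at h1
      | cons c v => cases c <;> simp_all
    | succ b =>
      refine ⟨a, b, v, rfl, ?_⟩
      cases v with
      | nil => exact Or.inl rfl
      | cons c v =>
        refine Or.inr ⟨by cases c <;> simp_all, ?_⟩
        simpa [List.getLast?_append] using h1

lemma cornerSum_replicate_false (F : Bool → ℤ → ℝ) (a : ℕ) (s : ℤ) (v : Word) :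
    cornerSum F s (List.replicate (a + 1) false ++ true :: v)
      = F false (s + a + 1) + cornerSum F (s + a + 1) (true :: v) := by
  induction a generalizing s with
  | zero => simp [cornerSum]
  | succ a ih =>
    have h := ih (s + 1)
    simp only [List.replicate_succ, List.cons_append, cornerSum, Bool.false_eq_true, if_false,
      zero_add] at h ⊢
    rw [h]
    push_cast
    ring_nf

lemma replicate_append_cons_self (a : Bool) (n : ℕ) (v : Word) :
    List.replicate n a ++ a :: v = a :: (List.replicate n a ++ v) := by
  rw [List.append_cons, ← List.replicate_succ', List.replicate_succ, List.cons_append]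

lemma cornerSum_replicate_true (F : Bool → ℤ → ℝ) (b : ℕ) (s : ℤ) (v : Word) :
    cornerSum F s (List.replicate b true ++ true :: v) = cornerSum F (s - b) (true :: v) := by
  induction b generalizing s with
  | zero => simp
  | succ b ih =>
    rw [List.replicate_succ, List.cons_append, replicate_append_cons_self, cornerSum_true_true,
      ← replicate_append_cons_self, ih]
    push_cast
    ring_nf

lemma cornerSum_pad_block (F : Bool → ℤ → ℝ) (a b : ℕ) (s : ℤ) (v : Word) :
    cornerSum F s (pad (List.replicate (a + 1) false ++ (List.replicate (b + 1) true ++ v)))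
      = F true (s - 1) + F false (s + a) + cornerSum F (s + a - b) (pad v) := by
  have h : pad (List.replicate (a + 1) false ++ (List.replicate (b + 1) true ++ v))
      = true :: (List.replicate (a + 1) false ++
        true :: (List.replicate b true ++ (v ++ [false]))) := by
    simp [pad, List.replicate_succ]
  have h2 : true :: (List.replicate b true ++ (v ++ [false])) = List.replicate b true ++ pad v := by
    rw [pad, replicate_append_cons_self]
  rw [h]
  have h3 : cornerSum F s (true :: (List.replicate (a + 1) false ++
        true :: (List.replicate b true ++ (v ++ [false]))))
      = F true (s - 1) + cornerSum F (s - 1) (List.replicate (a + 1) false ++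
        true :: (List.replicate b true ++ (v ++ [false]))) := by
    simp [List.replicate_succ, cornerSum]
  rw [h3, cornerSum_replicate_false, h2, pad, cornerSum_replicate_true, ← pad]
  ring_nf

/-! ### The Lyapunov function -/

/-- The weight `1 / (σ + 1)` of a height `σ ≥ 0`, extended by `1` to negative heights. -/
noncomputable def weight (s : ℤ) : ℝ := 1 / (max (s + 1) 1 : ℤ)

lemma weight_pos (s : ℤ) : 0 < weight s :=
  one_div_pos.2 (by exact_mod_cast (by lia : 0 < max (s + 1) 1))

lemma weight_antitone : Antitone weight := by
  intro s t h
  exact one_div_le_one_div_of_le (by exact_mod_cast (by lia : 0 < max (s + 1) 1))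
    (by exact_mod_cast (by lia : max (s + 1) 1 ≤ max (t + 1) 1))

lemma weight_natCast (n : ℕ) : weight n = 1 / ((n : ℝ) + 1) := by
  simp [weight]

/-- The harmonic numbers, extended linearly to negative integers. -/
noncomputable def harm (n : ℤ) : ℝ :=
  if 0 ≤ n then ∑ i ∈ Finset.range n.toNat, 1 / ((i : ℝ) + 1) else n

lemma harm_add_one (n : ℤ) : harm (n + 1) = harm n + weight n := by
  rcases lt_trichotomy n (-1) with h | rfl | h
  · have h1 : max (n + 1) 1 = 1 := by lia
    simp [harm, weight, h1, (by lia : ¬ 0 ≤ n), (by lia : ¬ 0 ≤ n + 1)]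
  · simp [harm, weight]
  · lift n to ℕ using by lia
    have h1 : ((n : ℤ) + 1).toNat = n + 1 := by lia
    rw [weight_natCast, harm, harm, if_pos (by lia), if_pos (by lia), h1, Finset.sum_range_succ,
      Int.toNat_natCast]

lemma harm_monotone : Monotone harm :=
  monotone_int_of_le_succ fun n => by
    rw [harm_add_one]
    exact le_add_of_nonneg_right (weight_pos n).le

lemma exists_lt_harm (C : ℝ) : ∃ n : ℕ, C < harm n := by
  obtain ⟨n, hn⟩ := (Real.tendsto_sum_range_one_div_nat_succ_atTop.eventually_gt_atTop C).exists
  exact ⟨n, by simpa [harm] using hn⟩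

/-- The potential of a word: the sum over its inversions, formed by the `j`-th `0` from the left
and the `k`-th `1` from the right, of `1 / (j + k)`. -/
noncomputable def potential (x : Word) : ℝ :=
  zeroSum (fun t => harm (t + 1)) (x.count true) x
    - ∑ i ∈ Finset.range (x.count false), harm (i + 1)

lemma potential_true_cons (x : Word) : potential (true :: x) = potential x := by
  simp [potential, zeroSum]

lemma potential_append_false (x : Word) : potential (x ++ [false]) = potential x := by
  simp only [potential, List.count_append, zeroSum_append]
  simp [zeroSum, Finset.sum_range_succ, count_true_add_height]

lemma potential_dropWhile (x : Word) : potential (x.dropWhile (· = true)) = potential x := by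
  induction x with
  | nil => rfl
  | cons a x ih => cases a <;> simp [potential_true_cons] at ih ⊢; exact ih

lemma strip_eq (x : Word) : strip x = (x.dropWhile (· = true)).rdropWhile (· = false) := rfl

lemma potential_rdropWhile (x : Word) : potential (x.rdropWhile (· = false)) = potential x := by
  induction x using List.reverseRecOn with
  | nil => rfl
  | append_singleton x a ih =>
    cases a
    · rw [List.rdropWhile_concat_pos _ _ _ (by simp), ih, potential_append_false]
    · rw [List.rdropWhile_concat_neg _ _ _ (by simp)]

lemma potential_strip (x : Word) : potential (strip x) = potential x := by
  rw [strip_eq, potential_rdropWhile, potential_dropWhile]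

lemma potential_pad (w : Word) : potential (pad w) = potential w := by
  rw [pad, potential_true_cons, potential_append_false]

lemma potential_nil : potential [] = 0 := by
  simp [potential, zeroSum]

/-- The potential, relative to the path that reads all the `1`s first, is nonnegative. -/
lemma zeroSum_sub_sum_nonneg (z : ℤ) (w : Word) :
    0 ≤ zeroSum (fun t => harm (t + 1)) (z + w.count true) w
      - ∑ i ∈ Finset.range (w.count false), harm (z + i + 1) := by
  induction w generalizing z with
  | nil => simp [zeroSum]
  | cons a w ih =>
    cases a
    · have h1 := ih (z + 1)
      have h2 : harm (z + 1) ≤ harm (z + w.count true + 1) := harm_monotone (by lia)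
      rw [List.count_cons_self, Finset.sum_range_succ', List.count_cons_of_ne (by simp), zeroSum]
      simp at h1 ⊢
      ring_nf at h1 h2 ⊢
      linarith
    · simpa [zeroSum, ← add_assoc] using ih z

lemma harm_sub_le_zeroSum_sub_sum (z : ℤ) (w : Word) (hw : w = [] ∨ w.getLast? = some true) :
    harm (z + w.count false + 1) - harm (z + 1)
      ≤ zeroSum (fun t => harm (t + 1)) (z + w.count true) w
        - ∑ i ∈ Finset.range (w.count false), harm (z + i + 1) := by
  induction w generalizing z with
  | nil => simp [zeroSum]
  | cons a w ih =>
    have hw' : w = [] ∨ w.getLast? = some true := by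
      cases w <;> simp_all
    cases a
    · have h1 := ih (z + 1) hw'
      have hc : 0 < w.count true := by
        rcases hw' with rfl | h
        · simp at hw
        · exact List.count_pos_iff.2 (List.mem_of_getLast? h)
      have h2 : harm (z + 1 + 1) ≤ harm (z + w.count true + 1) := harm_monotone (by lia)
      rw [List.count_cons_self, Finset.sum_range_succ', List.count_cons_of_ne (by simp), zeroSum]
      simp at h1 ⊢
      ring_nf at h1 h2 ⊢
      linarith
    · simpa [zeroSum, ← add_assoc] using ih z hw'

lemma finite_potential_le (C : ℝ) : {w | IsConfig w ∧ potential w ≤ C}.Finite := by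
  obtain ⟨n, hn⟩ := exists_lt_harm (C + harm 1)
  refine (List.finite_length_le Bool (n + n)).subset ?_
  rintro w ⟨hw, hC⟩
  have key : ∀ m : ℕ, harm (m + 1) - harm 1 ≤ C → m ≤ n := by
    intro m hm
    by_contra! h
    have : harm n ≤ harm (m + 1) := harm_monotone (by lia)
    linarith
  have h0 : w.count false ≤ n := by
    refine key _ (le_trans ?_ hC)
    have := harm_sub_le_zeroSum_sub_sum 0 w (hw.imp_right And.right)
    simpa [potential] using this
  have h1 : w.count true ≤ n := by
    refine key _ (le_trans ?_ hC)
    match w, hw with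
    | [], _ =>
      simp [potential_nil]
    | false :: w, _ =>
      have := zeroSum_sub_sum_nonneg 1 w
      rw [potential, List.count_cons_self, Finset.sum_range_succ',
        List.count_cons_of_ne (by simp), zeroSum]
      simp at this ⊢
      ring_nf at this ⊢
      linarith
    | true :: w, hw => simp [IsConfig] at hw
  have h2 : w.length = w.count true + w.count false := by
    rw [← List.count_not_add_count w false]
    rfl
  change w.length ≤ n + n
  lia

/-! ### Drift of the potential -/

lemma zeroSum_second_difference (s : ℤ) (u : Word) :
    zeroSum (fun t => harm (t + 1)) (s + 1) u + zeroSum (fun t => harm (t + 1)) (s - 1) u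
      - 2 * zeroSum (fun t => harm (t + 1)) s u
      = - zeroSum (fun t => weight t - weight (t + 1)) s u := by
  induction u generalizing s with
  | nil => simp [zeroSum]
  | cons a u ih =>
    cases a
    · have := ih (s + 1)
      have h1 := harm_add_one (s + 1)
      have h2 := harm_add_one s
      simp only [zeroSum, sub_add_cancel, add_sub_cancel_right] at this ⊢
      linarith
    · have := ih (s - 1)
      simp only [zeroSum, sub_add_cancel, add_sub_cancel_right] at this ⊢
      linarith

lemma potential_append_pair (u v : Word) (a b : Bool) (s : ℤ)
    (hs : s = (u ++ a :: b :: v).count true) :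
    potential (u ++ a :: b :: v)
      = zeroSum (fun t => harm (t + 1)) s u
        + zeroSum (fun t => harm (t + 1)) (s + height u) (a :: b :: v)
        - ∑ i ∈ Finset.range ((u ++ a :: b :: v).count false), harm (i + 1) := by
  rw [potential, ← hs, zeroSum_append]

/-- The two voter moves at a corner of height `σ` together change the potential by
`± weight σ` minus the variation of the weight. -/
lemma potential_voter (u v : Word) (a : Bool) (s : ℤ)
    (hs : s = (u ++ a :: (!a) :: v).count true) :
    potential (u ++ false :: false :: v) + potential (u ++ true :: true :: v)
        - 2 * potential (u ++ a :: (!a) :: v)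
      = -variation weight s (u ++ a :: (!a) :: v)
        + if a then weight (s + height (u ++ [a])) else -weight (s + height (u ++ [a])) := by
  have hend := count_true_add_height (u ++ a :: (!a) :: v)
  rw [variation_eq, hs, hend, ← hs, zeroSum_append _ s,
    potential_append_pair u v false false (s - 1) (by cases a <;> simp [hs] <;> ring),
    potential_append_pair u v true true (s + 1) (by cases a <;> simp [hs] <;> ring),
    potential_append_pair u v a (!a) s hs]
  have h1 := zeroSum_second_difference s u
  have h2 := zeroSum_second_difference (s + height u) v
  have h3 := harm_add_one (s + height u)
  have h4 := harm_add_one (u.count false + v.count false + 1)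
  have c0 : (u ++ false :: false :: v).count false = u.count false + v.count false + 1 + 1 := by
    simp; ring
  have c1 : (u ++ true :: true :: v).count false = u.count false + v.count false := by simp
  have c2 : (u ++ a :: (!a) :: v).count false = u.count false + v.count false + 1 := by
    cases a <;> simp <;> ring
  rw [c0, c1, c2]
  simp only [Finset.sum_range_succ]
  cases a <;>
  · simp [height_append, height, zeroSum] at h1 h2 h3 h4 ⊢
    ring_nf at h1 h2 h3 h4 ⊢
    linarith

/-- The change of the potential under an exclusion move. -/
lemma potential_swap (u v : Word) (a : Bool) (s : ℤ)
    (hs : s = (u ++ a :: (!a) :: v).count true) :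
    potential (u ++ (!a) :: a :: v) - potential (u ++ a :: (!a) :: v)
      = if a then weight (s + height (u ++ [a]) + 1) else -weight (s + height (u ++ [a]) - 1) := by
  rw [potential_append_pair u v a (!a) s hs,
    potential_append_pair u v (!a) a s (by cases a <;> simp [hs])]
  have h := harm_add_one (s + height u)
  cases a <;>
  · simp [height_append, height, zeroSum] at h ⊢
    ring_nf at h ⊢
    linarith

lemma cornerSum_pad_nil (F : Bool → ℤ → ℝ) (s : ℤ) : cornerSum F s (pad []) = F true (s - 1) := by
  simp [pad, cornerSum]

lemma one_div_add_le {x y : ℝ} (hx : 0 < x) (hy : 0 < y) (r : ℝ) :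
    1 / (x + y) ≤ r ^ 2 * (1 / x) + (1 - r) ^ 2 * (1 / y) := by
  rw [← sub_nonneg]
  have : r ^ 2 * (1 / x) + (1 - r) ^ 2 * (1 / y) - 1 / (x + y)
      = (r * y - (1 - r) * x) ^ 2 / (x * y * (x + y)) := by
    field_simp
    ring
  rw [this]
  positivity

lemma one_block_bound (a b : ℝ) (ha : 1 ≤ a) (hb : 1 ≤ b) :
    3 * (1 / (b + 2) + 1 / (a + 2)) ≤ 4 * (1 / (b + 1) - 1 / (a + b + 1) + 1 / (a + 1)) := by
  have h : ∀ x : ℝ, 1 ≤ x → 1 / (x + 1 / 2) ≤ 4 * (1 / (x + 1)) - 3 * (1 / (x + 2)) := by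
    intro x hx
    have h1 : 4 * (1 / (x + 1)) - 3 * (1 / (x + 2)) = (x + 5) / ((x + 1) * (x + 2)) := by
      field_simp
      ring
    rw [h1, div_le_div_iff₀ (by positivity) (by positivity)]
    nlinarith
  have h1 := one_div_add_le (by linarith : 0 < a + 1 / 2) (by linarith : 0 < b + 1 / 2) (1 / 2)
  rw [show a + 1 / 2 + (b + 1 / 2) = a + b + 1 by ring] at h1
  have h2 := h a ha
  have h3 := h b hb
  linarith

lemma two_block_bound_of_le {a d : ℝ} (c e : ℝ) (ha : 1 ≤ a) (hc : 1 ≤ c) (hd : 1 ≤ d)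
    (he : 1 ≤ e) (h : d ≤ a) :
    3 * (1 / (d + e + 2) + 1 / (a + d + 2) + 1 / (a + c + 2))
      ≤ 8 * (1 / (d + e + 1) - 1 / (a + d + e + 1) + 1 / (a + d + 1) - 1 / (a + c + d + 1)
        + 1 / (a + c + 1)) := by
  have h1 : 1 / (d + e + 2) ≤ 1 / (d + e + 1) := by gcongr; norm_num
  have h2 : 1 / (a + d + 2) ≤ 1 / (a + d + 1) := by gcongr; norm_num
  have h3 : 1 / (a + c + 2) ≤ 1 / (a + c + 1) := by gcongr; norm_num
  have h4 : 1 / (a + d + e + 1) ≤ 9 / 16 * (1 / (d + e + 1)) + 3 / 16 * (1 / (a + d + 1)) := by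
    have h5 := one_div_add_le (by linarith : 0 < d + e + 1) (by linarith : 0 < (a + d + 1) / 3)
      (3 / 4)
    have h6 : 1 / (a + d + e + 1) ≤ 1 / ((d + e + 1) + (a + d + 1) / 3) := by
      exact one_div_le_one_div_of_le (by linarith) (by linarith)
    have h7 : 1 / ((a + d + 1) / 3) = 3 * (1 / (a + d + 1)) := by field_simp
    rw [h7] at h5
    linarith
  have h5 : 1 / (a + c + d + 1) ≤ 1 / (a + c + 1) :=
    one_div_le_one_div_of_le (by linarith) (by linarith)
  have h6 : 1 / (a + c + d + 1) ≤ 1 / (a + d + 1) :=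
    one_div_le_one_div_of_le (by linarith) (by linarith)
  have h7 : 0 < 1 / (d + e + 1) := by positivity
  have h8 : 0 < 1 / (a + d + 1) := by positivity
  linarith

lemma two_block_bound (a c d e : ℝ) (ha : 1 ≤ a) (hc : 1 ≤ c) (hd : 1 ≤ d) (he : 1 ≤ e) :
    3 * (1 / (d + e + 2) + 1 / (a + d + 2) + 1 / (a + c + 2))
      ≤ 8 * (1 / (d + e + 1) - 1 / (a + d + e + 1) + 1 / (a + d + 1) - 1 / (a + c + d + 1)
        + 1 / (a + c + 1)) := by
  rcases le_total d a with h | h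
  · exact two_block_bound_of_le c e ha hc hd he h
  · have := two_block_bound_of_le e c hd he ha hc h
    ring_nf at this ⊢
    linarith

lemma minSum_le (w : Word) (hw : IsConfig w) (h0 : w ≠ []) (s : ℤ)
    (hs : s = (pad w).count true) :
    3 * cornerSum (fun a σ => if a then weight (σ + 1) else 0) s (pad w)
      ≤ 4 * (numMax s (pad w) * variation weight s (pad w)) := by
  have hS := cornerSum_min_le weight_antitone s (pad w) le_rfl
  rw [numMin_pad] at hS
  have hK : 0 ≤ variation weight s (pad w) :=
    (weight_pos s).le.trans (le_variation weight_antitone _ _)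
  obtain ⟨a, b, v, rfl, hv⟩ := hw.exists_block h0
  by_cases hv0 : v = []
  · subst hv0
    rw [← cornerSum_alternating_pad weight, numMax]
    simp only [cornerSum_pad_block, cornerSum_pad_nil]
    have hs' : s = b + 2 := by rw [hs]; simp [pad, List.count_replicate]; ring
    have := one_block_bound (a + 1) (b + 1) (by simp) (by simp)
    have w1 := weight_natCast (b + 1)
    have w2 := weight_natCast (b + 2)
    have w3 := weight_natCast (a + 1)
    have w4 := weight_natCast (a + 2)
    have w5 := weight_natCast (a + b + 2)
    subst hs'
    push_cast at *
    simp
    ring_nf at *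
    simp only [w1, w2, w3, w4, w5]
    linarith
  obtain ⟨c, d, v, rfl, hv'⟩ := hv.exists_block hv0
  by_cases hv1 : v = []
  · subst hv1
    rw [← cornerSum_alternating_pad weight, numMax]
    simp only [cornerSum_pad_block, cornerSum_pad_nil]
    have hs' : s = b + d + 3 := by rw [hs]; simp [pad, List.count_replicate]; ring
    have := two_block_bound (a + 1) (c + 1) (d + 1) (b + 1) (by simp) (by simp) (by simp) (by simp)
    have w1 := weight_natCast (b + d + 2)
    have w2 := weight_natCast (b + d + 3)
    have w3 := weight_natCast (a + d + 2)
    have w4 := weight_natCast (a + d + 3)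
    have w5 := weight_natCast (a + c + 2)
    have w6 := weight_natCast (a + c + 3)
    have w7 := weight_natCast (a + b + d + 3)
    have w8 := weight_natCast (a + c + d + 3)
    subst hs'
    push_cast at *
    simp
    ring_nf at *
    simp only [w1, w2, w3, w4, w5, w6, w7, w8]
    linarith
  obtain ⟨e, f, v, rfl, hv⟩ := hv'.exists_block hv1
  have hN : 3 ≤ numMax s (pad (List.replicate (a + 1) false ++ (List.replicate (b + 1) true ++
      (List.replicate (c + 1) false ++ (List.replicate (d + 1) true ++
      (List.replicate (e + 1) false ++ (List.replicate (f + 1) true ++ v))))))) := by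
    have := numMax_nonneg (s + a - b + c - d + e - f) (pad v)
    rw [numMax] at this ⊢
    simp only [cornerSum_pad_block]
    simp
    linarith
  nlinarith

/-! ### The transitions of the chain -/

/-- The possible moves out of a word, with their probabilities. -/
noncomputable def moves (β p : ℝ) (w : Word) : List (ℝ × Word) :=
  (unlike w).flatMap fun i =>
    let swapProb := if (pad w).getD i true then 1 - p else p
    [(((unlike w).length : ℝ)⁻¹ * (β * (1 / 2)), strip (setPair (pad w) i false false)),
      (((unlike w).length : ℝ)⁻¹ * (β * (1 / 2)), strip (setPair (pad w) i true true)),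
      (((unlike w).length : ℝ)⁻¹ * ((1 - β) * swapProb), strip (swapPair (pad w) i)),
      (((unlike w).length : ℝ)⁻¹ * ((1 - β) * (1 - swapProb)), w)]

lemma sum_moves (β p : ℝ) (w : Word) (f : Word → ℝ) :
    ((moves β p w).map fun m => m.1 * f m.2).sum
      = ((unlike w).map fun i => ((unlike w).length : ℝ)⁻¹ *
        (β * (1 / 2) * f (strip (setPair (pad w) i false false))
          + β * (1 / 2) * f (strip (setPair (pad w) i true true))
          + (1 - β) * (if (pad w).getD i true then 1 - p else p) * f (strip (swapPair (pad w) i))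
          + (1 - β) * (1 - (if (pad w).getD i true then 1 - p else p)) * f w)).sum := by
  rw [moves]
  generalize ((unlike w).length : ℝ)⁻¹ = c
  induction unlike w with
  | nil => simp
  | cons i l ih =>
    rw [List.flatMap_cons, List.map_append, List.sum_append, ih, List.map_cons, List.sum_cons]
    simp only [List.map_cons, List.map_nil, List.sum_cons, List.sum_nil]
    ring

lemma P_eq_sum_moves (β p : ℝ) (w w' : Word) :
    P β p w w' = ((moves β p w).map fun m => m.1 * if m.2 = w' then 1 else 0).sum := by
  rw [sum_moves β p w fun z => if z = w' then 1 else 0, P]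

lemma unlike_eq_corners (w : Word) : unlike w = corners (pad w) := by
  simp [unlike, corners, pad]

lemma exists_of_mem_corners {x : Word} {i : ℕ} (hi : i ∈ corners x) :
    ∃ (u : Word) (a : Bool) (v : Word), x = u ++ a :: (!a) :: v ∧ u.length = i := by
  simp only [corners, List.mem_filter, List.mem_range, decide_eq_true_eq] at hi
  obtain ⟨hi, h⟩ := hi
  have h1 : i + 1 < x.length := by lia
  refine ⟨x.take i, x[i], x.drop (i + 2), ?_, by simp; lia⟩
  have h2 : (!x[i]) = x[i + 1] := by
    rw [List.getD_eq_getElem _ _ h1, List.getD_eq_getElem _ _ (by lia)] at h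
    revert h
    cases x[i] <;> cases x[i + 1] <;> simp
  rw [h2, ← List.drop_eq_getElem_cons, ← List.drop_eq_getElem_cons, List.take_append_drop]

lemma setPair_append (u v : Word) (a b c d : Bool) :
    setPair (u ++ a :: b :: v) u.length c d = u ++ c :: d :: v := by
  simp [setPair]

lemma swapPair_append (u v : Word) (a b : Bool) :
    swapPair (u ++ a :: b :: v) u.length = u ++ b :: a :: v := by
  rw [swapPair, setPair_append]
  simp

/-- The expected change of the potential at a corner of height `σ` of the word `x`, where `a` is
the first symbol of the corner. -/
noncomputable def cornerDrift (β p : ℝ) (x : Word) (a : Bool) (σ : ℤ) : ℝ :=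
  β / 2 * (-variation weight (x.count true) x + if a then weight σ else -weight σ)
    + (1 - β) * if a then (1 - p) * weight (σ + 1) else -(p * weight (σ - 1))

lemma potential_drift_corner (β p : ℝ) (w : Word) {i : ℕ} (hi : i ∈ unlike w) :
    β * (1 / 2) * potential (strip (setPair (pad w) i false false))
        + β * (1 / 2) * potential (strip (setPair (pad w) i true true))
        + (1 - β) * (if (pad w).getD i true then 1 - p else p)
          * potential (strip (swapPair (pad w) i))
        + (1 - β) * (1 - (if (pad w).getD i true then 1 - p else p)) * potential w
      = potential w + cornerDrift β p (pad w) ((pad w).getD i true)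
        ((pad w).count true + height ((pad w).take (i + 1))) := by
  rw [unlike_eq_corners] at hi
  obtain ⟨u, a, v, hx, rfl⟩ := exists_of_mem_corners hi
  rw [← potential_pad w, hx, setPair_append, setPair_append, swapPair_append]
  simp only [potential_strip]
  have ha : (u ++ a :: (!a) :: v).getD u.length true = a := by simp
  have ht : (u ++ a :: (!a) :: v).take (u.length + 1) = u ++ [a] := by
    simp [List.take_append, List.take_of_length_le]
  rw [ha, ht, cornerDrift]
  have h1 := potential_voter u v a _ rfl
  have h2 := potential_swap u v a _ rfl
  cases a
  · simp only [Bool.false_eq_true, if_false] at h1 h2 ⊢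
    linear_combination β / 2 * h1 + (1 - β) * p * h2
  · simp only [if_true] at h1 h2 ⊢
    linear_combination β / 2 * h1 + (1 - β) * (1 - p) * h2

lemma length_unlike_pos (w : Word) : 0 < (unlike w).length := by
  have h := length_corners_pad 0 w
  have h1 := numMax_nonneg 0 (pad w)
  rw [unlike_eq_corners]
  have : (0 : ℝ) < (corners (pad w)).length := by linarith
  exact_mod_cast this

lemma sum_moves_fst (β p : ℝ) (w : Word) : ((moves β p w).map fun m => m.1).sum = 1 := by
  have h := sum_moves β p w fun _ => 1
  have h1 := length_unlike_pos w
  simp only [mul_one] at h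
  rw [h]
  have h2 : ∀ s : ℝ, β * (1 / 2) + β * (1 / 2) + (1 - β) * s + (1 - β) * (1 - s) = 1 := by
    intro s
    ring
  simp only [h2]
  simp
  field_simp

lemma sum_cornerDrift_nonpos {β p : ℝ} (hp0 : 0 ≤ p) (hβ : 4 / 7 ≤ β)
    (hβ1 : β ≤ 1) {w : Word} (hw : IsConfig w) (h0 : w ≠ []) :
    cornerSum (cornerDrift β p (pad w)) ((pad w).count true) (pad w) ≤ 0 := by
  obtain ⟨s, hs⟩ : ∃ s : ℤ, s = (pad w).count true := ⟨_, rfl⟩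
  rw [← hs]
  have hK := (weight_pos s).le.trans (le_variation weight_antitone s (pad w))
  set K : ℝ := variation weight s (pad w) with hKdef
  have hmono : cornerSum (cornerDrift β p (pad w)) s (pad w)
      ≤ cornerSum (fun a σ => (-(β / 2 * K) * 1 + β / 2 * (if a then weight σ else -weight σ))
        + (1 - β) * if a then weight (σ + 1) else 0) s (pad w) := by
    refine cornerSum_mono (fun a σ => ?_) s (pad w)
    rw [cornerDrift, ← hs, ← hKdef]
    have h1 : (if a then (1 - p) * weight (σ + 1) else -(p * weight (σ - 1)))
        ≤ if a then weight (σ + 1) else 0 := by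
      have h2 := mul_nonneg hp0 (weight_pos (σ + 1)).le
      have h3 := mul_nonneg hp0 (weight_pos (σ - 1)).le
      cases a <;> simp <;> linarith
    have := mul_le_mul_of_nonneg_left h1 (by linarith : 0 ≤ 1 - β)
    linarith
  have hlen : cornerSum (fun _ _ => 1) s (pad w) = 2 * numMax s (pad w) + 1 := by
    rw [← length_corners_pad]
    simp [← sum_corners]
  rw [cornerSum_add, cornerSum_add, cornerSum_const_mul, cornerSum_const_mul, cornerSum_const_mul,
    cornerSum_alternating_pad, hlen, ← hKdef] at hmono
  have hmin := minSum_le w hw h0 s hs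
  rw [← hKdef] at hmin
  have hNK := mul_nonneg (numMax_nonneg s (pad w)) hK
  have h1 := mul_le_mul_of_nonneg_left hmin (by linarith : 0 ≤ 1 - β)
  have h2 := mul_le_mul_of_nonneg_right hβ hNK
  linarith

/-- The potential is a supermartingale away from the ground state. -/
lemma sum_moves_potential_le {β p : ℝ} (hp0 : 0 ≤ p) (hβ : 4 / 7 ≤ β)
    (hβ1 : β ≤ 1) {w : Word} (hw : IsConfig w) (h0 : w ≠ []) :
    ((moves β p w).map fun m => m.1 * potential m.2).sum ≤ potential w := by
  rw [sum_moves]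
  have h : ∀ i ∈ unlike w, _ := fun i hi =>
    congrArg (((unlike w).length : ℝ)⁻¹ * ·) (potential_drift_corner β p w hi)
  rw [List.map_congr_left h, List.sum_map_mul_left, List.sum_map_add]
  have h1 := sum_cornerDrift_nonpos hp0 hβ hβ1 hw h0
  rw [← sum_corners, ← unlike_eq_corners] at h1
  have h2 : (0 : ℝ) < (unlike w).length := by exact_mod_cast length_unlike_pos w
  rw [inv_mul_le_iff₀ h2]
  simpa using h1

lemma moves_nonneg {β p : ℝ} (hp0 : 0 ≤ p) (hp1 : p ≤ 1) (hβ0 : 0 ≤ β) (hβ1 : β ≤ 1) (w : Word) :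
    ∀ m ∈ moves β p w, 0 ≤ m.1 := by
  intro m hm
  obtain ⟨i, -, hm⟩ := List.mem_flatMap.1 hm
  have h1 : 0 ≤ 1 - β := by linarith
  have h2 : 0 ≤ 1 - p := by linarith
  simp only [List.mem_cons, List.not_mem_nil, or_false] at hm
  rcases hm with rfl | rfl | rfl | rfl
  · positivity
  · positivity
  · simp only
    split_ifs <;> positivity
  · simp only
    split_ifs
    · rw [sub_sub_cancel]
      positivity
    · positivity

lemma isConfig_strip (x : Word) : IsConfig (strip x) := by
  rw [strip_eq, IsConfig]
  by_cases h : (x.dropWhile (· = true)).rdropWhile (· = false) = []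
  · exact Or.inl h
  · refine Or.inr ⟨?_, ?_⟩
    · obtain ⟨t, ht⟩ := List.rdropWhile_prefix (fun a : Bool => decide (a = false))
        (x.dropWhile (· = true))
      have h1 := List.head?_dropWhile_not (fun a : Bool => decide (a = true)) x
      rw [← ht, List.head?_append_of_ne_nil _ h, List.head?_eq_some_head h] at h1
      rw [List.head?_eq_some_head h]
      simpa using h1
    · have := List.rdropWhile_last_not (fun a : Bool => decide (a = false)) _ h
      rw [List.getLast?_eq_some_getLast h]
      simpa using this

lemma isConfig_of_mem_moves {β p : ℝ} {w : Word} (hw : IsConfig w) :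
    ∀ m ∈ moves β p w, IsConfig m.2 := by
  intro m hm
  obtain ⟨i, -, hm⟩ := List.mem_flatMap.1 hm
  simp only [List.mem_cons, List.not_mem_nil, or_false] at hm
  rcases hm with rfl | rfl | rfl | rfl
  · exact isConfig_strip _
  · exact isConfig_strip _
  · exact isConfig_strip _
  · exact hw

lemma length_strip_le (x : Word) : (strip x).length ≤ x.length := by
  rw [strip_eq]
  exact (List.rdropWhile_prefix _ _).length_le.trans (List.dropWhile_sublist _).length_le

lemma strip_append_false (x : Word) : strip (x ++ [false]) = strip x := by
  rw [strip_eq, strip_eq, List.dropWhile_append]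
  split_ifs with h
  · rw [List.isEmpty_iff.1 h]
    simp
  · exact List.rdropWhile_concat_pos _ _ _ (by simp)

/-- Some move shortens the hybrid zone. -/
lemma exists_move_length_lt {β p : ℝ} (hβ0 : 0 < β) {w : Word} (hw : IsConfig w) (h0 : w ≠ []) :
    ∃ m ∈ moves β p w, 0 < m.1 ∧ m.2.length < w.length := by
  match w, hw, h0 with
  | true :: v, hw, _ => simp [IsConfig] at hw
  | false :: v, _, _ =>
    have h1 : 0 ∈ unlike (false :: v) := by simp [unlike, pad]
    refine ⟨_, List.mem_flatMap.2 ⟨0, h1, List.mem_cons_of_mem _ List.mem_cons_self⟩, ?_, ?_⟩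
    · have : (0 : ℝ) < (unlike (false :: v)).length := by exact_mod_cast length_unlike_pos _
      positivity
    · have h2 : strip (setPair (pad (false :: v)) 0 true true) = strip v := by
        rw [← strip_append_false v]
        simp [setPair, pad, strip_eq]
      rw [h2]
      exact Nat.lt_succ_of_le (length_strip_le v)

/-! ### Survival probabilities -/

/-- The function `f`, set to zero at the ground state. -/
noncomputable def killed (f : Word → ℝ) (w : Word) : ℝ := if w = [] then 0 else f w

/-- The probability of avoiding the ground state during the first `n` steps. -/
noncomputable def survival (β p : ℝ) : ℕ → Word → ℝ
  | 0, _ => 1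
  | n + 1, w => ((moves β p w).map fun m => m.1 * killed (survival β p n) m.2).sum

lemma killed_mono {f g : Word → ℝ} (h : ∀ w, f w ≤ g w) (w : Word) : killed f w ≤ killed g w := by
  unfold killed
  split_ifs
  exacts [le_rfl, h w]

lemma killed_nonneg {f : Word → ℝ} (h : ∀ w, 0 ≤ f w) (w : Word) : 0 ≤ killed f w := by
  unfold killed
  split_ifs
  exacts [le_rfl, h w]

section Survival

variable {β p : ℝ}

lemma survival_nonneg (hm : ∀ w, ∀ m ∈ moves β p w, 0 ≤ m.1) (n : ℕ) (w : Word) :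
    0 ≤ survival β p n w := by
  induction n generalizing w with
  | zero => exact zero_le_one
  | succ n ih =>
    refine List.sum_nonneg fun r hr => ?_
    obtain ⟨m, hmem, rfl⟩ := List.mem_map.1 hr
    exact mul_nonneg (hm w m hmem) (killed_nonneg ih _)

lemma survival_succ_le (hm : ∀ w, ∀ m ∈ moves β p w, 0 ≤ m.1) (n : ℕ) (w : Word) :
    survival β p (n + 1) w ≤ survival β p n w := by
  induction n generalizing w with
  | zero =>
    rw [survival, survival, ← sum_moves_fst β p w]
    refine List.sum_le_sum fun m hmem => mul_le_of_le_one_right (hm w m hmem) ?_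
    simp only [killed, survival]
    split_ifs <;> norm_num
  | succ n ih =>
    rw [survival, survival]
    exact List.sum_le_sum fun m hmem => mul_le_mul_of_nonneg_left (killed_mono ih _) (hm w m hmem)

/-- A bounded function that vanishes at the ground state and is harmonic elsewhere is nonpositive,
by comparison with the potential. -/
lemma nonpos_of_harmonic (hp0 : 0 ≤ p) (hp1 : p ≤ 1) (hβ : 4 / 7 ≤ β) (hβ1 : β ≤ 1)
    {f : Word → ℝ} (hf1 : ∀ w, f w ≤ 1) (hf0 : f [] = 0)
    (hf : ∀ w, w ≠ [] → f w = ((moves β p w).map fun m => m.1 * f m.2).sum)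
    {w : Word} (hw : IsConfig w) : f w ≤ 0 := by
  have key : ∀ ε > 0, f w ≤ ε * potential w := by
    intro ε hε
    by_contra! hlt
    set g : Word → ℝ := fun w => f w - ε * potential w with hg
    have hgw : 0 < g w := by simp only [hg]; linarith
    have hfin : {z | IsConfig z ∧ g w ≤ g z}.Finite := by
      refine (finite_potential_le (1 / ε)).subset fun z hz => ⟨hz.1, ?_⟩
      have h1 : 0 < g z := hgw.trans_le hz.2
      rw [le_div_iff₀ hε]
      have := hf1 z
      simp only [hg] at h1
      linarith
    obtain ⟨y, hy, hymax⟩ := Set.exists_max_image _ g hfin ⟨w, hw, le_rfl⟩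
    have hmax : ∀ z, IsConfig z → g z ≤ g y := by
      intro z hz
      by_cases h : g w ≤ g z
      · exact hymax z ⟨hz, h⟩
      · exact (not_le.1 h).le.trans hy.2
    have hall : ∀ n, ∀ z, IsConfig z → g z = g y → z.length ≠ n := by
      intro n
      induction n using Nat.strong_induction_on with
      | _ n ih =>
      intro z hz hzy hzn
      have hz0 : z ≠ [] := by
        rintro rfl
        have h1 : g [] = 0 := by simp [hg, hf0, potential_nil]
        have := hgw.trans_le hy.2
        linarith
      obtain ⟨m, hmem, hm0, hml⟩ := exists_move_length_lt (p := p) (by linarith : 0 < β) hz hz0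
      refine ih _ (hzn ▸ hml) m.2 (isConfig_of_mem_moves hz m hmem) ?_ rfl
      by_contra hne
      have hlt := lt_of_le_of_ne (hmax _ (isConfig_of_mem_moves hz m hmem)) hne
      have h1 : ((moves β p z).map fun m => m.1 * g m.2).sum
          < ((moves β p z).map fun m => m.1 * g y).sum := by
        refine List.sum_lt_sum _ _ (fun m' hm' => ?_) ⟨m, hmem, ?_⟩
        · exact mul_le_mul_of_nonneg_left (hmax _ (isConfig_of_mem_moves hz m' hm'))
            (moves_nonneg hp0 hp1 (by linarith) hβ1 z m' hm')
        · exact mul_lt_mul_of_pos_left hlt hm0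
      rw [List.sum_map_mul_right, sum_moves_fst, one_mul, ← hzy] at h1
      have h2 : ((moves β p z).map fun m => m.1 * g m.2).sum
          = ((moves β p z).map fun m => m.1 * f m.2).sum
            - ε * ((moves β p z).map fun m => m.1 * potential m.2).sum := by
        rw [← List.sum_map_mul_left, eq_sub_iff_add_eq, ← List.sum_map_add]
        congr 1
        refine List.map_congr_left fun m _ => ?_
        simp only [hg]
        ring
      have h3 := mul_le_mul_of_nonneg_left (sum_moves_potential_le hp0 hβ hβ1 hz hz0) hε.le
      rw [h2, ← hf z hz0] at h1
      simp only [hg] at h1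
      linarith
    exact hall _ y hy.1 rfl rfl
  refine le_of_forall_pos_le_add fun δ hδ => ?_
  have h1 : 0 < |potential w| + 1 := by positivity
  refine (key (δ / (|potential w| + 1)) (by positivity)).trans ?_
  rw [zero_add, div_mul_eq_mul_div, div_le_iff₀ h1]
  exact mul_le_mul_of_nonneg_left ((le_abs_self _).trans (by linarith)) hδ.le

lemma tendsto_sum_map_mul (l : List (ℝ × Word)) {F : ℕ → Word → ℝ} {f : Word → ℝ}
    (h : ∀ w, Tendsto (fun n => F n w) atTop (nhds (f w))) :
    Tendsto (fun n => (l.map fun m => m.1 * F n m.2).sum) atTop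
      (nhds (l.map fun m => m.1 * f m.2).sum) := by
  induction l with
  | nil => simp
  | cons m l ih => simpa using ((h m.2).const_mul m.1).add ih

lemma tendsto_survival (hp0 : 0 ≤ p) (hp1 : p ≤ 1) (hβ : 4 / 7 ≤ β) (hβ1 : β ≤ 1)
    {w : Word} (hw : IsConfig w) :
    Tendsto (fun n => survival β p n w) atTop (nhds 0) := by
  have hm := moves_nonneg hp0 hp1 (by linarith : 0 ≤ β) hβ1
  have hanti : ∀ w, Antitone fun n => survival β p n w := fun w =>
    antitone_nat_of_succ_le fun n => survival_succ_le hm n w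
  have hbdd : ∀ w, BddBelow (Set.range fun n => survival β p n w) := fun w =>
    ⟨0, by rintro _ ⟨n, rfl⟩; exact survival_nonneg hm n w⟩
  set q : Word → ℝ := fun w => ⨅ n, survival β p n w
  have hq : ∀ w, Tendsto (fun n => survival β p n w) atTop (nhds (q w)) := fun w =>
    tendsto_atTop_ciInf (hanti w) (hbdd w)
  have hk : ∀ w, Tendsto (fun n => killed (survival β p n) w) atTop (nhds (killed q w)) := by
    intro w
    unfold killed
    split_ifs
    exacts [tendsto_const_nhds, hq w]
  have hrec : ∀ w, q w = ((moves β p w).map fun m => m.1 * killed q m.2).sum := fun w =>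
    tendsto_nhds_unique ((hq w).comp (tendsto_add_atTop_nat 1)) (tendsto_sum_map_mul _ hk)
  have hq1 : ∀ w, q w ≤ 1 := fun w => ciInf_le (hbdd w) 0
  have hq0 : ∀ w, 0 ≤ q w := fun w => le_ciInf fun n => survival_nonneg hm n w
  have hzero : ∀ w, IsConfig w → killed q w = 0 := by
    intro w hw
    refine le_antisymm (nonpos_of_harmonic hp0 hp1 hβ hβ1 (fun w => ?_) (if_pos rfl)
      (fun w h => ?_) hw) (killed_nonneg hq0 w)
    · unfold killed
      split_ifs
      exacts [zero_le_one, hq1 w]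
    · rw [← hrec, killed, if_neg h]
  have : q w = 0 := by
    rw [hrec, List.sum_eq_zero]
    intro r hr
    obtain ⟨m, hmem, rfl⟩ := List.mem_map.1 hr
    rw [hzero _ (isConfig_of_mem_moves hw m hmem), mul_zero]
  exact this ▸ hq w

end Survival

/-! ### Realizations of the chain -/

lemma tsum_ofReal_sum_mul (l : List (ℝ × Word)) (hl : ∀ m ∈ l, 0 ≤ m.1) {f : Word → ℝ}
    (hf : ∀ w, 0 ≤ f w) :
    ∑' w, ENNReal.ofReal ((l.map fun m => m.1 * if m.2 = w then 1 else 0).sum)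
        * ENNReal.ofReal (f w)
      = ENNReal.ofReal ((l.map fun m => m.1 * f m.2).sum) := by
  induction l with
  | nil => simp
  | cons m l ih =>
    have hl' : ∀ m ∈ l, 0 ≤ m.1 := fun m' h => hl m' (List.mem_cons_of_mem _ h)
    have hm : 0 ≤ m.1 := hl m List.mem_cons_self
    have h1 : ∀ w, 0 ≤ (l.map fun m => m.1 * if m.2 = w then (1 : ℝ) else 0).sum := by
      intro w
      refine List.sum_nonneg fun r hr => ?_
      obtain ⟨m', hmem, rfl⟩ := List.mem_map.1 hr
      exact mul_nonneg (hl' m' hmem) (by split_ifs <;> norm_num)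
    have h2 : 0 ≤ (l.map fun m => m.1 * f m.2).sum := by
      refine List.sum_nonneg fun r hr => ?_
      obtain ⟨m', hmem, rfl⟩ := List.mem_map.1 hr
      exact mul_nonneg (hl' m' hmem) (hf _)
    have h3 : ∀ w, (0 : ℝ) ≤ m.1 * if m.2 = w then 1 else 0 := fun w =>
      mul_nonneg hm (by split_ifs <;> norm_num)
    simp only [List.map_cons, List.sum_cons]
    rw [ENNReal.ofReal_add (mul_nonneg hm (hf _)) h2, ← ih hl', ENNReal.ofReal_mul hm]
    simp_rw [fun w => ENNReal.ofReal_add (h3 w) (h1 w), add_mul]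
    rw [ENNReal.tsum_add, tsum_eq_single m.2]
    · simp
    · intro w hw
      simp [hw.symm]

lemma tsum_P_mul_killed_survival {β p : ℝ} (hm : ∀ w, ∀ m ∈ moves β p w, 0 ≤ m.1) (n : ℕ)
    (w : Word) :
    ∑' w', ENNReal.ofReal (P β p w w') * ENNReal.ofReal (killed (survival β p n) w')
      = ENNReal.ofReal (survival β p (n + 1) w) := by
  simp_rw [P_eq_sum_moves]
  rw [tsum_ofReal_sum_mul _ (hm w) (killed_nonneg (survival_nonneg hm n)), survival]

lemma measure_avoid_le {β p : ℝ} (hm : ∀ w, ∀ m ∈ moves β p w, 0 ≤ m.1)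
    {Ω : Type*} [MeasurableSpace Ω] {μ : Measure Ω} {ξ : ℕ → Ω → Word} (hξ : IsEVChain β p μ ξ)
    (n t : ℕ) (path : ℕ → Word) :
    μ {ω | (∀ i ≤ t, ξ i ω = path i) ∧ ∀ j, t < j → j ≤ t + n → ξ j ω ≠ []}
      ≤ μ {ω | ∀ i ≤ t, ξ i ω = path i} * ENNReal.ofReal (survival β p n (path t)) := by
  induction n generalizing t path with
  | zero =>
    simp only [survival, ENNReal.ofReal_one, mul_one]
    exact measure_mono fun ω hω => hω.1
  | succ n ih =>
    have hcover : {ω | (∀ i ≤ t, ξ i ω = path i) ∧ ∀ j, t < j → j ≤ t + (n + 1) → ξ j ω ≠ []}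
        ⊆ ⋃ w : Word, {ω | w ≠ [] ∧ (∀ i ≤ t + 1, ξ i ω = Function.update path (t + 1) w i) ∧
          ∀ j, t + 1 < j → j ≤ t + 1 + n → ξ j ω ≠ []} := by
      rintro ω ⟨h1, h2⟩
      refine Set.mem_iUnion.2 ⟨ξ (t + 1) ω, h2 _ (by lia) (by lia), fun i hi => ?_,
        fun j hj hj' => h2 j (by lia) (by lia)⟩
      rcases eq_or_ne i (t + 1) with rfl | hne
      · simp
      · rw [Function.update_of_ne hne]
        exact h1 i (by lia)
    refine (measure_mono hcover).trans ((measure_iUnion_le _).trans ?_)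
    rw [← tsum_P_mul_killed_survival hm, ← ENNReal.tsum_mul_left]
    refine ENNReal.tsum_le_tsum fun w => ?_
    by_cases hw : w = []
    · simp [hw]
    · have hprefix : {ω | ∀ i ≤ t, ξ i ω = Function.update path (t + 1) w i}
          = {ω | ∀ i ≤ t, ξ i ω = path i} := by
        ext ω
        refine forall₂_congr fun i hi => ?_
        rw [Function.update_of_ne (by lia)]
      have h1 := ih (t + 1) (Function.update path (t + 1) w)
      rw [hξ.2, hprefix, Function.update_self, Function.update_of_ne (by lia)] at h1
      rw [killed, if_neg hw, ← mul_assoc]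
      exact (measure_mono fun ω hω => hω.2).trans h1


/-- Theorem 4 (recurrence): for `p < 1/2` and `β ≥ 4/7`, the chain is recurrent:
`Pr_{β,p}(τ < ∞ | ξ₀ = S₀) = 1` for every `S₀ ∈ 𝒟`. -/
theorem recurrent_of_beta_ge_four_sevenths
    (p : ℝ) (hp0 : 0 ≤ p) (hp : p < 1 / 2)
    (β : ℝ) (hβ : 4 / 7 ≤ β) (hβ1 : β ≤ 1)
    (S₀ : Word) (hS₀ : IsConfig S₀)
    {Ω : Type*} [MeasurableSpace Ω] (μ : Measure Ω) [IsProbabilityMeasure μ]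
    (ξ : ℕ → Ω → Word) (hchain : IsEVChain β p μ ξ)
    (hinit : ∀ᵐ ω ∂μ, ξ 0 ω = S₀) :
    μ {ω | ∃ t : ℕ, 0 < t ∧ ξ t ω = groundState} = 1 := by
  have hp1 : p ≤ 1 := by linarith
  have hm := moves_nonneg hp0 hp1 (by linarith : 0 ≤ β) hβ1
  have hmeas : MeasurableSet {ω | ∃ t : ℕ, 0 < t ∧ ξ t ω = groundState} := by
    have : {ω | ∃ t : ℕ, 0 < t ∧ ξ t ω = groundState}
        = ⋃ t : ℕ, ⋃ _ : 0 < t, ξ t ⁻¹' {groundState} := by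
      ext ω
      simp
    rw [this]
    exact MeasurableSet.iUnion fun t => MeasurableSet.iUnion fun _ =>
      hchain.1 t MeasurableSpace.measurableSet_top
  rw [← prob_compl_eq_zero_iff hmeas]
  have hle : ∀ n, μ {ω | ∃ t : ℕ, 0 < t ∧ ξ t ω = groundState}ᶜ
      ≤ ENNReal.ofReal (survival β p n S₀) := by
    intro n
    have h1 : μ {ω | ∃ t : ℕ, 0 < t ∧ ξ t ω = groundState}ᶜ
        ≤ μ {ω | (∀ i ≤ 0, ξ i ω = S₀) ∧ ∀ j, 0 < j → j ≤ 0 + n → ξ j ω ≠ []} := by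
      refine measure_mono_ae ?_
      filter_upwards [hinit] with ω h0 hω
      refine ⟨fun i hi => ?_, fun j hj _ h => hω ⟨j, hj, h⟩⟩
      rw [Nat.le_zero.1 hi, h0]
    refine h1.trans ((measure_avoid_le hm hchain n 0 fun _ => S₀).trans ?_)
    exact mul_le_of_le_one_left' prob_le_one
  have hlim := ENNReal.tendsto_ofReal (tendsto_survival hp0 hp1 hβ hβ1 hS₀)
  rw [ENNReal.ofReal_zero] at hlim
  exact le_antisymm (ge_of_tendsto' hlim hle) zero_le

end EV
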